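/- In a decomposition finite category C, for every object X the automorphism group Aut(X) (equivalently, the type of isomorphisms X ≅ X) is finite, and there are only finitely many objects isomorphic to X, i.e., the type { Y : C // Nonempty (X ≅ Y) } is finite. -/

import Mathlib

open CategoryTheory

universe v u

variable (C : Type u) [Category.{v} C]

/-- A category is decomposition finite if every morphism has only finitely many
factorizations into a pair of composable morphisms. -/
def DecompositionFinite : Prop :=
  ∀ (X Y : C) (φ : X ⟶ Y),
    Finite {p : Σ Z : C, (X ⟶ Z) × (Z ⟶ Y) // p.2.1 ≫ p.2.2 = φ}

theorem finite_aut_and_iso_of_decompositionFinite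
    (h : DecompositionFinite C) (X : C) :
    Finite (X ≅ X) ∧ Finite {Y : C // Nonempty (X ≅ Y)} := by
  have hX := h X X (𝟙 X)
  constructor
  · refine Finite.of_injective
      (fun e : X ≅ X => (⟨⟨X, e.hom, e.inv⟩, e.hom_inv_id⟩ :
        {p : Σ Z : C, (X ⟶ Z) × (Z ⟶ X) // p.2.1 ≫ p.2.2 = 𝟙 X})) ?_
    intro e f hef
    have h1 := congrArg Subtype.val hef
    simp only [Sigma.mk.injEq, heq_eq_eq, true_and, Prod.mk.injEq] at h1
    exact Iso.ext h1.1
  · refine Finite.of_injective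
      (fun Y : {Y : C // Nonempty (X ≅ Y)} =>
        (⟨⟨Y.1, Y.2.some.hom, Y.2.some.inv⟩, Y.2.some.hom_inv_id⟩ :
        {p : Σ Z : C, (X ⟶ Z) × (Z ⟶ X) // p.2.1 ≫ p.2.2 = 𝟙 X})) ?_
    intro Y Z hYZ
    exact Subtype.ext (congrArg (fun q => q.1.1) hYZ)
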